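/- Containers for general order-hereditary properties: Let k ≥ 2, let P be an order-hereditary property of k-colourings with P_n ≠ ∅ for every n ∈ ℕ, and let ε > 0 and m ∈ ℕ be fixed. There exists n₀ such that for any n ≥ n₀ there is a collection T_n of k-colouring templates for K_n satisfying: (i) T_n is a container family for P_n; (ii) every t ∈ T_n has Ent(t) ≤ (π(P)+ε)·C(n,2); (iii) for every t ∈ T_n, the number of pairs (φ, c) with φ ∈ binom(K_n,K_m), c ∉ P_m and c ∈ ⟨t|φ⟩ is at most ε·C(n,m); and (iv) |T_n| ≤ k^{ε·C(n,2)}. -/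

import Mathlib

open Filter

abbrev Edge (n : ℕ) := {p : Fin n × Fin n // p.1 < p.2}

abbrev Colouring (k n : ℕ) := Edge n → Fin k

abbrev Template (k n : ℕ) := Edge n → Finset (Fin k)

def Proper {k n : ℕ} (t : Template k n) : Prop := ∀ e, (t e).Nonempty

def Realises {k n : ℕ} (c : Colouring k n) (t : Template k n) : Prop := ∀ e, c e ∈ t e

noncomputable def Ent {k n : ℕ} (t : Template k n) : ℝ :=
  ∑ e : Edge n, Real.logb k ((t e).card)

def Edge.map {m n : ℕ} (φ : Fin m → Fin n) (h : StrictMono φ) (e : Edge m) : Edge n :=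
  ⟨(φ e.1.1, φ e.1.2), h e.2⟩

def restrictC {k m n : ℕ} (c : Colouring k n) (φ : Fin m → Fin n) (h : StrictMono φ) :
    Colouring k m := fun e => c (Edge.map φ h e)

def restrictT {k m n : ℕ} (t : Template k n) (φ : Fin m → Fin n) (h : StrictMono φ) :
    Template k m := fun e => t (Edge.map φ h e)

def Forb {k N : ℕ} (F : Set (Colouring k N)) (n : ℕ) : Set (Colouring k n) :=
  {c | ∀ (φ : Fin N → Fin n) (h : StrictMono φ), restrictC c φ h ∉ F}

def OrderHereditary {k : ℕ} (P : ∀ n, Set (Colouring k n)) : Prop :=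
  ∀ (m n : ℕ) (φ : Fin m → Fin n) (h : StrictMono φ) (c : Colouring k n),
    c ∈ P n → restrictC c φ h ∈ P m

noncomputable def exEnt {k n : ℕ} (A : Set (Colouring k n)) : ℝ :=
  sSup {x | ∃ t : Template k n, Proper t ∧ (∀ c, Realises c t → c ∈ A) ∧ Ent t = x}

noncomputable def badPairs {k N n : ℕ} (t : Template k n) (F : Set (Colouring k N)) : ℕ :=
  Set.ncard {p : (Fin N → Fin n) × Colouring k N |
    ∃ h : StrictMono p.1, p.2 ∈ F ∧ Realises p.2 (restrictT t p.1 h)}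

def TemplateLE {k m n : ℕ} (t : Template k m) (t' : Template k n) : Prop :=
  ∃ (φ : Fin m → Fin n) (h : StrictMono φ), ∀ e, t e ⊆ restrictT t' φ h e

def IsContainerFamily {k n : ℕ} (T : Finset (Template k n)) (A : Set (Colouring k n)) : Prop :=
  ∀ t : Template k n, Proper t → (∀ c, Realises c t → c ∈ A) → ∃ t' ∈ T, TemplateLE t t'

open Finset in
noncomputable def cellG {Ω L : Type*} [Fintype Ω] [DecidableEq L] (l : Ω → L) (f : Ω → ℝ) (a : L) : ℝ :=
  (∑ w with l w = a, f w) / (#{w | l w = a} : ℝ)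

section FK
open Finset

variable {Ω L : Type*} [Fintype Ω] [DecidableEq L]

lemma cellG_mul (l : Ω → L) (f : Ω → ℝ) (g : L → ℝ) :
    ∑ w, cellG l f (l w) * g (l w) = ∑ w, f w * g (l w) := by
  classical
  have h1 : ∀ w, cellG l f (l w) * g (l w)
      = ∑ v, if l v = l w then f v * g (l v) / (#{w' | l w' = l v} : ℝ) else 0 := by
    intro w
    unfold cellG
    rw [← Finset.sum_filter, Finset.sum_div, Finset.sum_mul]
    refine Finset.sum_congr rfl fun v hv => ?_
    rw [(Finset.mem_filter.1 hv).2]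
    ring
  simp_rw [h1]
  rw [Finset.sum_comm]
  refine Finset.sum_congr rfl fun v _ => ?_
  rw [← Finset.sum_filter, Finset.sum_const, nsmul_eq_mul]
  have h2 : (#{w | l v = l w} : ℝ) = (#{w' | l w' = l v} : ℝ) := by
    congr 2
    ext w
    simp [eq_comm]
  rw [h2]
  have h3 : (#{w' | l w' = l v} : ℝ) ≠ 0 := by
    have : 0 < #{w' | l w' = l v} := Finset.card_pos.2 ⟨v, by simp⟩
    positivity
  field_simp

lemma cellG_nonneg (l : Ω → L) (f : Ω → ℝ) (hf : ∀ w, 0 ≤ f w) (a : L) : 0 ≤ cellG l f a :=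
  div_nonneg (Finset.sum_nonneg fun _ _ => hf _) (by positivity)

lemma cellG_le_one (l : Ω → L) (f : Ω → ℝ) (hf : ∀ w, f w ≤ 1) (a : L) : cellG l f a ≤ 1 := by
  refine div_le_one_of_le₀ ?_ (by positivity)
  calc _ ≤ ∑ w with l w = a, (1 : ℝ) := Finset.sum_le_sum fun _ _ => hf _
    _ = _ := by simp

lemma energy_incr {L' : Type*} [DecidableEq L'] (l : Ω → L) (l' : Ω → L') (h : L' → L)
    (hl : ∀ w, l w = h (l' w)) (f : Ω → ℝ) (g : L' → ℝ) (hg : ∀ a, g a ^ 2 ≤ 1)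
    (γ : ℝ) (hγ : 0 < γ) (hΩ : 0 < Fintype.card Ω)
    (hbad : γ * Fintype.card Ω < ∑ w, (cellG l f (l w) - f w) * g (l' w)) :
    ∑ w, cellG l f (l w) ^ 2 + γ ^ 2 * Fintype.card Ω ≤ ∑ w, cellG l' f (l' w) ^ 2 := by
  set u : Ω → ℝ := fun w => cellG l' f (l' w) with hu
  set v : Ω → ℝ := fun w => cellG l f (l w) with hv
  have e1 : ∑ w, u w * g (l' w) = ∑ w, f w * g (l' w) := cellG_mul l' f g
  have e2 : ∑ w, u w * v w = ∑ w, f w * v w := by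
    simpa [hv, hl] using cellG_mul l' f (fun a => cellG l f (h a))
  have e3 : ∑ w, v w * v w = ∑ w, f w * v w := cellG_mul l f (cellG l f)
  have e4 : ∑ w, (v w - f w) * g (l' w) = ∑ w, (v w - u w) * g (l' w) := by
    simp only [sub_mul, Finset.sum_sub_distrib, e1]
  have e5 : ∑ w, (v w - u w) ^ 2 = ∑ w, u w ^ 2 - ∑ w, v w ^ 2 := by
    have : ∀ w, (v w - u w) ^ 2 = u w ^ 2 - 2 * (u w * v w) + v w * v w := fun w => by ring
    simp_rw [this, Finset.sum_add_distrib, Finset.sum_sub_distrib, ← Finset.mul_sum, e2, ← e3]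
    simp_rw [pow_two]
    ring
  have cs := Finset.sum_mul_sq_le_sq_mul_sq (Finset.univ) (fun w => v w - u w) (fun w => g (l' w))
  have e6 : ∑ w, g (l' w) ^ 2 ≤ Fintype.card Ω := by
    calc _ ≤ ∑ w : Ω, (1 : ℝ) := Finset.sum_le_sum fun _ _ => hg _
      _ = _ := by simp
  change γ * Fintype.card Ω < ∑ w, (v w - f w) * g (l' w) at hbad
  rw [e4] at hbad
  have hc : (0 : ℝ) < Fintype.card Ω := by exact_mod_cast hΩ
  have e7 : (γ * Fintype.card Ω) ^ 2 ≤ (∑ w, (v w - u w) * g (l' w)) ^ 2 :=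
    pow_le_pow_left₀ (by positivity) hbad.le 2
  have e8 : (γ * Fintype.card Ω) ^ 2 ≤ (∑ w, (v w - u w) ^ 2) * Fintype.card Ω :=
    e7.trans (cs.trans (mul_le_mul_of_nonneg_left e6 (Finset.sum_nonneg fun _ _ => sq_nonneg _)))
  have e9 : γ ^ 2 * Fintype.card Ω ≤ ∑ w, (v w - u w) ^ 2 := by
    refine le_of_mul_le_mul_right ?_ hc
    calc _ = (γ * Fintype.card Ω) ^ 2 := by ring
      _ ≤ _ := e8
  rw [e5] at e9
  change ∑ w, v w ^ 2 + _ ≤ ∑ w, u w ^ 2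
  linarith

/-- labelling of the square -/
def prodLab {X : Type*} (p q : X → ℕ) (z : X × X) : ℕ × ℕ := (p z.1, q z.2)

lemma fk_iter {X : Type*} [Fintype X] [DecidableEq X] [Nonempty X] (f : X × X → ℝ)
    (γ : ℝ) (hγ : 0 < γ)
    (j : ℕ) : (∃ p q : X → ℕ, (∀ x, p x < 2 ^ j) ∧ (∀ x, q x < 2 ^ j) ∧
      ∀ S T : Finset X, ∑ x ∈ S, ∑ y ∈ T, (cellG (prodLab p q) f (p x, q y) - f (x, y))
        ≤ γ * Fintype.card (X × X)) ∨
    (∃ p q : X → ℕ, (∀ x, p x < 2 ^ j) ∧ (∀ x, q x < 2 ^ j) ∧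
      j * (γ ^ 2 * Fintype.card (X × X)) ≤ ∑ w, cellG (prodLab p q) f (prodLab p q w) ^ 2) := by
  induction j with
  | zero =>
    right
    exact ⟨fun _ => 0, fun _ => 0, by simp, by simp, by
      simp only [Nat.cast_zero, zero_mul]
      exact Finset.sum_nonneg fun _ _ => sq_nonneg _⟩
  | succ j ih =>
    rcases ih with ⟨p, q, hp, hq, hgood⟩ | ⟨p, q, hp, hq, hE⟩
    · left
      refine ⟨p, q, fun x => (hp x).trans_le ?_, fun x => (hq x).trans_le ?_, hgood⟩ <;>
      exact Nat.pow_le_pow_right (by norm_num) (Nat.le_succ j)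
    · by_cases hg : ∀ S T : Finset X, ∑ x ∈ S, ∑ y ∈ T,
        (cellG (prodLab p q) f (p x, q y) - f (x, y)) ≤ γ * Fintype.card (X × X)
      · left
        refine ⟨p, q, fun x => (hp x).trans_le ?_, fun x => (hq x).trans_le ?_, hg⟩ <;>
        exact Nat.pow_le_pow_right (by norm_num) (Nat.le_succ j)
      · right
        push Not at hg
        obtain ⟨S, T, hST⟩ := hg
        refine ⟨fun x => 2 * p x + if x ∈ S then 1 else 0,
          fun x => 2 * q x + if x ∈ T then 1 else 0, fun x => ?_, fun x => ?_, ?_⟩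
        · have := hp x
          dsimp only
          rw [pow_succ]
          split_ifs <;> omega
        · have := hq x
          dsimp only
          rw [pow_succ]
          split_ifs <;> omega
        · have key := energy_incr (prodLab p q)
            (prodLab (fun x => 2 * p x + if x ∈ S then 1 else 0)
              (fun x => 2 * q x + if x ∈ T then 1 else 0))
            (fun a => (a.1 / 2, a.2 / 2))
            (by
              intro w
              simp only [prodLab, Prod.mk.injEq]
              constructor <;> split_ifs <;> omega) f
            (fun a => (if a.1 % 2 = 1 then 1 else 0) * (if a.2 % 2 = 1 then 1 else 0))
            (by intro a; split_ifs <;> simp) γ hγ Fintype.card_pos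
            (by
              refine hST.trans_le (le_of_eq ?_)
              rw [Fintype.sum_prod_type, ← Finset.sum_filter_add_sum_filter_not univ (· ∈ S)]
              have z : ∀ x : X, (2 * p x + if x ∈ S then 1 else 0) % 2 = 1 ↔ x ∈ S := by
                intro x; split_ifs <;> simp [*]
              have z' : ∀ x : X, (2 * q x + if x ∈ T then 1 else 0) % 2 = 1 ↔ x ∈ T := by
                intro x; split_ifs <;> simp [*]
              simp only [prodLab, z, z']
              have hS : (univ.filter (· ∈ S)) = S := by ext; simp
              have hT : (univ.filter (· ∈ T)) = T := by ext; simp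
              rw [hS]
              have h0 : ∑ x with x ∉ S, ∑ y, (cellG (prodLab p q) f (p x, q y) - f (x, y)) *
                  ((if x ∈ S then (1 : ℝ) else 0) * if y ∈ T then 1 else 0) = 0 := by
                refine Finset.sum_eq_zero fun x hx => Finset.sum_eq_zero fun y _ => ?_
                simp [(Finset.mem_filter.1 hx).2]
              rw [show (prodLab p q) = fun z : X × X => (p z.1, q z.2) from rfl] at h0 ⊢
              rw [h0, add_zero]
              refine Finset.sum_congr rfl fun x hx => ?_
              simp only [hx, if_true, mul_ite, mul_one, mul_zero]
              rw [← Finset.sum_filter, hT])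
          push_cast
          linarith

lemma cut_functions {X : Type*} [Fintype X] (D : X → X → ℝ) (B : ℝ)
    (h : ∀ S T : Finset X, ∑ x ∈ S, ∑ y ∈ T, D x y ≤ B)
    (u v : X → ℝ) (hu0 : ∀ x, 0 ≤ u x) (hu1 : ∀ x, u x ≤ 1)
    (hv0 : ∀ x, 0 ≤ v x) (hv1 : ∀ x, v x ≤ 1) :
    ∑ x, ∑ y, D x y * (u x * v y) ≤ B := by
  have lin : ∀ (w : X → ℝ) (g : X → ℝ), (∀ x, 0 ≤ w x) → (∀ x, w x ≤ 1) →
      ∃ S : Finset X, ∑ x, w x * g x ≤ ∑ x ∈ S, g x := by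
    intro w g h0 h1
    refine ⟨univ.filter (fun x => 0 ≤ g x), ?_⟩
    rw [Finset.sum_filter]
    refine Finset.sum_le_sum fun x _ => ?_
    split_ifs with hx
    · exact mul_le_of_le_one_left hx (h1 x)
    · exact mul_nonpos_of_nonneg_of_nonpos (h0 x) (not_le.1 hx).le
  obtain ⟨S, hS⟩ := lin u (fun x => ∑ y, D x y * v y) hu0 hu1
  obtain ⟨T, hT⟩ := lin v (fun y => ∑ x ∈ S, D x y) hv0 hv1
  calc ∑ x, ∑ y, D x y * (u x * v y) = ∑ x, u x * ∑ y, D x y * v y := by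
        refine Finset.sum_congr rfl fun x _ => ?_
        rw [Finset.mul_sum]
        exact Finset.sum_congr rfl fun y _ => by ring
    _ ≤ _ := hS
    _ = ∑ y, v y * ∑ x ∈ S, D x y := by
        rw [Finset.sum_comm]
        refine Finset.sum_congr rfl fun y _ => ?_
        rw [Finset.mul_sum]
        exact Finset.sum_congr rfl fun x _ => by ring
    _ ≤ _ := hT
    _ ≤ B := by rw [Finset.sum_comm]; exact h S T

lemma fk_main (γ η : ℝ) (hγ : 0 < γ) (hη : 0 < η) : ∃ K : ℕ, 0 < K ∧ ∀ n : ℕ, 0 < n →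
    ∀ f : Fin n → Fin n → ℝ, (∀ x y, 0 ≤ f x y) → (∀ x y, f x y ≤ 1) →
    ∃ (p q : Fin n → Fin K) (H : Finset (Fin K × Fin K)) (W : Fin n → Fin n → ℝ),
      (∀ x y, 0 ≤ W x y) ∧ (∀ x y, W x y ≤ 1) ∧
      (∀ u v : Fin n → ℝ, (∀ x, 0 ≤ u x) → (∀ x, u x ≤ 1) → (∀ x, 0 ≤ v x) → (∀ x, v x ≤ 1) →
        ∑ x, ∑ y, (W x y - f x y) * (u x * v y) ≤ γ * (n : ℝ) ^ 2) ∧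
      (∀ x y, (p x, q y) ∈ H ↔ η ≤ W x y) ∧
      ∑ x, ∑ y, (if η ≤ W x y then 0 else f x y) ≤ η * (n : ℝ) ^ 2 := by
  classical
  obtain ⟨M, hM⟩ := exists_nat_gt (1 / γ ^ 2)
  refine ⟨2 ^ M, by positivity, fun n hn f hf0 hf1 => ?_⟩
  have : Nonempty (Fin n) := ⟨⟨0, hn⟩⟩
  have hcard : (Fintype.card (Fin n × Fin n) : ℝ) = (n : ℝ) ^ 2 := by
    simp [pow_two]
  have hn2 : (0 : ℝ) < (n : ℝ) ^ 2 := by positivity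
  rcases fk_iter (fun z : Fin n × Fin n => f z.1 z.2) γ hγ M with
    ⟨p, q, hp, hq, hgood⟩ | ⟨p, q, hp, hq, hE⟩
  swap
  · exfalso
    have h1 : ∑ w, cellG (prodLab p q) (fun z : Fin n × Fin n => f z.1 z.2) (prodLab p q w) ^ 2
        ≤ (n : ℝ) ^ 2 := by
      rw [← hcard]
      calc _ ≤ ∑ w : Fin n × Fin n, (1 : ℝ) := Finset.sum_le_sum fun w _ =>
            pow_le_one₀ (cellG_nonneg _ _ (fun _ => hf0 _ _) _) (cellG_le_one _ _ (fun _ => hf1 _ _) _)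
        _ = _ := by simp
    rw [hcard] at hE
    have h2 : 1 < (M : ℝ) * γ ^ 2 := by
      rwa [div_lt_iff₀ (by positivity)] at hM
    nlinarith
  · set G := cellG (prodLab p q) (fun z : Fin n × Fin n => f z.1 z.2) with hG
    refine ⟨fun x => ⟨p x, hp x⟩, fun x => ⟨q x, hq x⟩,
      univ.filter (fun a => η ≤ G (a.1, a.2)), fun x y => G (p x, q y),
      fun x y => cellG_nonneg _ _ (fun _ => hf0 _ _) _, fun x y => cellG_le_one _ _ (fun _ => hf1 _ _) _,
      ?_, ?_, ?_⟩
    · intro u v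
      rw [hcard] at hgood
      exact cut_functions (fun x y => G (p x, q y) - f x y) _ hgood u v
    · intro x y
      simp
    · have h1 := cellG_mul (prodLab p q) (fun z : Fin n × Fin n => f z.1 z.2)
        (fun a => if η ≤ G a then 0 else 1)
      rw [← hG, Fintype.sum_prod_type, Fintype.sum_prod_type] at h1
      calc (∑ x, ∑ y, if η ≤ G (p x, q y) then 0 else f x y)
          = ∑ x, ∑ y, f x y * (if η ≤ G (p x, q y) then 0 else 1) := by
            refine Finset.sum_congr rfl fun x _ => Finset.sum_congr rfl fun y _ => ?_
            split_ifs <;> simp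
        _ = ∑ x, ∑ y, G (p x, q y) * (if η ≤ G (p x, q y) then 0 else 1) := h1.symm
        _ ≤ ∑ x : Fin n, ∑ y : Fin n, η := Finset.sum_le_sum fun x _ => Finset.sum_le_sum fun y _ => by
            split_ifs with hh
            · simpa using hη.le
            · simpa using (not_le.1 hh).le
        _ = _ := by simp; ring

end FK
section Count
open Finset

lemma sum_update {ι X : Type*} [Fintype ι] [DecidableEq ι] [Fintype X] (a : ι)
    (G : (ι → X) → ℝ) :
    ∑ x : ι → X, ∑ s : X, G (Function.update x a s) = Fintype.card X * ∑ x, G x := by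
  classical
  have inv : Function.Involutive
      (fun z : (ι → X) × X => ((Function.update z.1 a z.2, z.1 a) : (ι → X) × X)) := by
    intro z
    simp
  have h := Equiv.sum_comp inv.toPerm (fun z : (ι → X) × X => G z.1)
  rw [Fintype.sum_prod_type, Fintype.sum_prod_type] at h
  simp only [Function.Involutive.coe_toPerm, Finset.sum_const, nsmul_eq_mul, Finset.card_univ] at h
  rw [h, Finset.mul_sum]

lemma sum_update2 {ι X : Type*} [Fintype ι] [DecidableEq ι] [Fintype X] (a b : ι)
    (G : (ι → X) → ℝ) :
    ∑ x : ι → X, ∑ s : X, ∑ t : X, G (Function.update (Function.update x a s) b t)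
      = (Fintype.card X : ℝ) ^ 2 * ∑ x, G x := by
  rw [sum_update a (fun x => ∑ t : X, G (Function.update x b t)), sum_update b G]
  ring

lemma count_step {N n : ℕ} (hn : 0 < n) (γ : ℝ)
    (B : {p : Fin N × Fin N // p.1 < p.2} → Fin n → Fin n → ℝ)
    (hB0 : ∀ e x y, 0 ≤ B e x y) (hB1 : ∀ e x y, B e x y ≤ 1)
    (e₀ : {p : Fin N × Fin N // p.1 < p.2}) (D : Fin n → Fin n → ℝ)
    (hD : ∀ u v : Fin n → ℝ, (∀ x, 0 ≤ u x) → (∀ x, u x ≤ 1) → (∀ x, 0 ≤ v x) → (∀ x, v x ≤ 1) →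
        ∑ x, ∑ y, D x y * (u x * v y) ≤ γ * (n : ℝ) ^ 2) :
    ∑ x : Fin N → Fin n, D (x e₀.1.1) (x e₀.1.2) *
      ∏ e ∈ univ.erase e₀, B e (x e.1.1) (x e.1.2) ≤ γ * (n : ℝ) ^ N := by
  have hn2 : (0 : ℝ) < (n : ℝ) ^ 2 := by positivity
  refine le_of_mul_le_mul_left ?_ hn2
  have h := sum_update2 (X := Fin n) e₀.1.1 e₀.1.2
    (fun x : Fin N → Fin n => D (x e₀.1.1) (x e₀.1.2) *
      ∏ e ∈ univ.erase e₀, B e (x e.1.1) (x e.1.2))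
  rw [Fintype.card_fin] at h
  rw [← h]
  have hab : e₀.1.1 ≠ e₀.1.2 := ne_of_lt e₀.2
  calc _ ≤ ∑ x : Fin N → Fin n, γ * (n : ℝ) ^ 2 := by
        refine Finset.sum_le_sum fun x _ => ?_
        refine le_trans (le_of_eq ?_) (hD
          (fun s => ∏ e ∈ (univ.erase e₀).filter (fun e => ¬ (e.1.1 = e₀.1.2 ∨ e.1.2 = e₀.1.2)),
            B e (Function.update x e₀.1.1 s e.1.1) (Function.update x e₀.1.1 s e.1.2))
          (fun t => ∏ e ∈ (univ.erase e₀).filter (fun e => (e.1.1 = e₀.1.2 ∨ e.1.2 = e₀.1.2)),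
            B e (Function.update x e₀.1.2 t e.1.1) (Function.update x e₀.1.2 t e.1.2))
          (fun s => Finset.prod_nonneg fun _ _ => hB0 _ _ _)
          (fun s => Finset.prod_le_one (fun _ _ => hB0 _ _ _) fun _ _ => hB1 _ _ _)
          (fun s => Finset.prod_nonneg fun _ _ => hB0 _ _ _)
          (fun s => Finset.prod_le_one (fun _ _ => hB0 _ _ _) fun _ _ => hB1 _ _ _))
        refine Finset.sum_congr rfl fun s _ => Finset.sum_congr rfl fun t _ => ?_
        rw [Function.update_self, Function.update_of_ne hab, Function.update_self]
        congr 1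
        rw [← Finset.prod_filter_not_mul_prod_filter _
          (fun e : {p : Fin N × Fin N // p.1 < p.2} => (e.1.1 = e₀.1.2 ∨ e.1.2 = e₀.1.2))]
        congr 1
        · refine Finset.prod_congr rfl fun e he => ?_
          simp only [Finset.mem_filter, not_or] at he
          rw [Function.update_of_ne he.2.1, Function.update_of_ne he.2.2]
        · refine Finset.prod_congr rfl fun e he => ?_
          simp only [Finset.mem_filter, Finset.mem_erase, Finset.mem_univ, and_true] at he
          have h1 : e.1.1 ≠ e₀.1.1 := by
            intro hh
            rcases he.2 with h2 | h2
            · exact hab (hh.symm.trans h2)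
            · exact he.1 (Subtype.ext (Prod.ext hh h2))
          have h2 : e.1.2 ≠ e₀.1.1 := by
            intro hh
            rcases he.2 with h2 | h2
            · have a1 := e.2
              have a2 := e₀.2
              rw [h2, hh] at a1
              exact absurd a1 (not_lt.2 a2.le)
            · exact hab (hh.symm.trans h2)
          have key : ∀ i, i ≠ e₀.1.1 → Function.update (Function.update x e₀.1.1 s) e₀.1.2 t i
              = Function.update x e₀.1.2 t i := by
            intro i hi
            simp [Function.update_apply, hi]
          rw [key _ h1, key _ h2]
    _ = _ := by
        simp
        ring

lemma count_main {N n : ℕ} (hn : 0 < n) (γ : ℝ)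
    (A W : {p : Fin N × Fin N // p.1 < p.2} → Fin n → Fin n → ℝ)
    (hA0 : ∀ e x y, 0 ≤ A e x y) (hA1 : ∀ e x y, A e x y ≤ 1)
    (hW0 : ∀ e x y, 0 ≤ W e x y) (hW1 : ∀ e x y, W e x y ≤ 1)
    (hD : ∀ e, ∀ u v : Fin n → ℝ, (∀ x, 0 ≤ u x) → (∀ x, u x ≤ 1) →
      (∀ x, 0 ≤ v x) → (∀ x, v x ≤ 1) →
        ∑ x, ∑ y, (W e x y - A e x y) * (u x * v y) ≤ γ * (n : ℝ) ^ 2) :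
    ∑ x : Fin N → Fin n, ∏ e, W e (x e.1.1) (x e.1.2) ≤
      ∑ x : Fin N → Fin n, ∏ e, A e (x e.1.1) (x e.1.2) +
        Fintype.card {p : Fin N × Fin N // p.1 < p.2} * γ * (n : ℝ) ^ N := by
  have main : ∀ D : Finset {p : Fin N × Fin N // p.1 < p.2},
      ∑ x : Fin N → Fin n, ∏ e, (if e ∈ D then W e else A e) (x e.1.1) (x e.1.2) ≤
      ∑ x : Fin N → Fin n, ∏ e, A e (x e.1.1) (x e.1.2) + #D * γ * (n : ℝ) ^ N := by
    intro D
    induction D using Finset.induction_on with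
    | empty => simp
    | insert e₀ D he ih =>
      have st := count_step hn γ (fun e => if e ∈ D then W e else A e)
        (fun e x y => by split_ifs <;> simp [*]) (fun e x y => by split_ifs <;> simp [*])
        e₀ (fun x y => W e₀ x y - A e₀ x y) (hD e₀)
      have : ∀ x : Fin N → Fin n,
          ∏ e, (if e ∈ insert e₀ D then W e else A e) (x e.1.1) (x e.1.2) =
          ∏ e, (if e ∈ D then W e else A e) (x e.1.1) (x e.1.2) +
          (W e₀ (x e₀.1.1) (x e₀.1.2) - A e₀ (x e₀.1.1) (x e₀.1.2)) *
            ∏ e ∈ univ.erase e₀, (if e ∈ D then W e else A e) (x e.1.1) (x e.1.2) := by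
        intro x
        rw [← Finset.mul_prod_erase univ _ (Finset.mem_univ e₀),
          ← Finset.mul_prod_erase univ (fun e => (if e ∈ D then W e else A e) (x e.1.1) (x e.1.2))
            (Finset.mem_univ e₀)]
        have hh : ∏ e ∈ univ.erase e₀, (if e ∈ insert e₀ D then W e else A e) (x e.1.1) (x e.1.2)
            = ∏ e ∈ univ.erase e₀, (if e ∈ D then W e else A e) (x e.1.1) (x e.1.2) := by
          refine Finset.prod_congr rfl fun e hne => ?_
          have := Finset.ne_of_mem_erase hne
          simp [Finset.mem_insert, this]
        rw [hh]
        simp only [Finset.mem_insert_self, if_true, he, if_false]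
        ring
      simp_rw [this]
      rw [Finset.sum_add_distrib, Finset.card_insert_of_notMem he]
      push_cast
      linarith
  have := main univ
  simpa using this

end Count
section Bad
open Finset

/-- indicator of colour `i` being available at `x < y` -/
noncomputable def indT {k n : ℕ} (t : Template k n) (i : Fin k) (x y : Fin n) : ℝ :=
  if ∃ h : x < y, i ∈ t ⟨(x, y), h⟩ then 1 else 0

lemma indT_nonneg {k n : ℕ} (t : Template k n) (i : Fin k) (x y : Fin n) : 0 ≤ indT t i x y := by
  unfold indT; split_ifs <;> norm_num

lemma indT_le_one {k n : ℕ} (t : Template k n) (i : Fin k) (x y : Fin n) : indT t i x y ≤ 1 := by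
  unfold indT; split_ifs <;> norm_num

lemma Edge.map_injective {m n : ℕ} (φ : Fin m → Fin n) (h : StrictMono φ) :
    Function.Injective (Edge.map φ h) := by
  intro e e' hh
  have h1 := congrArg (fun z : Edge n => z.1.1) hh
  have h2 := congrArg (fun z : Edge n => z.1.2) hh
  exact Subtype.ext (Prod.ext (h.injective h1) (h.injective h2))

lemma no_bad {k n N : ℕ} (P : ∀ n, Set (Colouring k n)) (hP : OrderHereditary P)
    (t : Template k n) (ht : Proper t) (hsub : ∀ c, Realises c t → c ∈ P n)
    (φ : Fin N → Fin n) (h : StrictMono φ) (c : Colouring k N)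
    (hc : Realises c (restrictT t φ h)) : c ∈ P N := by
  choose d hd using ht
  have hr : restrictC (Function.extend (Edge.map φ h) c d) φ h = c := by
    funext e
    exact (Edge.map_injective φ h).extend_apply c d e
  rw [← hr]
  apply hP
  apply hsub
  intro e
  by_cases he : ∃ e', Edge.map φ h e' = e
  · obtain ⟨e', rfl⟩ := he
    rw [(Edge.map_injective φ h).extend_apply]
    exact hc e'
  · rw [Function.extend_apply' _ _ _ he]
    exact hd e

lemma prod_ind_realise {k n N : ℕ} (t : Template k n) (c : Colouring k N) (x : Fin N → Fin n)
    (hx : ∏ e : Edge N, indT t (c e) (x e.1.1) (x e.1.2) ≠ 0) :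
    ∃ h : StrictMono x, Realises c (restrictT t x h) := by
  have h1 : ∀ e : Edge N, ∃ h : x e.1.1 < x e.1.2, c e ∈ t ⟨(x e.1.1, x e.1.2), h⟩ := by
    intro e
    have := (Finset.prod_ne_zero_iff.1 hx) e (Finset.mem_univ e)
    unfold indT at this
    by_contra hcon
    simp [hcon] at this
  refine ⟨fun i j hij => (h1 ⟨(i, j), hij⟩).1, fun e => ?_⟩
  exact (h1 e).2

lemma bad_bound {k n N : ℕ} (hn : 0 < n) (P : ∀ n, Set (Colouring k n)) (hP : OrderHereditary P)
    (t : Template k n) (ht : Proper t) (hsub : ∀ c, Realises c t → c ∈ P n)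
    (t' : Template k n) (η γ : ℝ) (hη : 0 < η) (hγ : 0 < γ) (W : Fin k → Fin n → Fin n → ℝ)
    (hW0 : ∀ i x y, 0 ≤ W i x y) (hW1 : ∀ i x y, W i x y ≤ 1)
    (hcut : ∀ i, ∀ u v : Fin n → ℝ, (∀ x, 0 ≤ u x) → (∀ x, u x ≤ 1) →
      (∀ x, 0 ≤ v x) → (∀ x, v x ≤ 1) →
        ∑ x, ∑ y, (W i x y - indT t i x y) * (u x * v y) ≤ γ * (n : ℝ) ^ 2)
    (hlow : ∀ i, ∑ x, ∑ y, (if η ≤ W i x y then 0 else indT t i x y) ≤ η * (n : ℝ) ^ 2)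
    (hcov : ∀ e i, i ∈ t' e → ¬ η ≤ W i e.1.1 e.1.2 → i ∈ t e) :
    (badPairs t' (P N)ᶜ : ℝ) ≤ (k : ℝ) ^ Fintype.card (Edge N) *
      (Fintype.card (Edge N) * γ / η ^ Fintype.card (Edge N) + Fintype.card (Edge N) * η)
        * (n : ℝ) ^ N := by
  classical
  set r := Fintype.card (Edge N) with hr
  have percol : ∀ c : Colouring k N, c ∉ P N →
      ∑ x : Fin N → Fin n, ∏ e : Edge N, indT t' (c e) (x e.1.1) (x e.1.2)
        ≤ (r * γ / η ^ r + r * η) * (n : ℝ) ^ N := by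
    intro c hc
    have h1 : ∀ x : Fin N → Fin n, ∏ e : Edge N, indT t' (c e) (x e.1.1) (x e.1.2) ≤
        (∏ e : Edge N, W (c e) (x e.1.1) (x e.1.2)) / η ^ r +
        ∑ e : Edge N, (if η ≤ W (c e) (x e.1.1) (x e.1.2) then 0
          else indT t (c e) (x e.1.1) (x e.1.2)) := by
      intro x
      have hs0 : ∀ e : Edge N, 0 ≤ (if η ≤ W (c e) (x e.1.1) (x e.1.2) then 0
          else indT t (c e) (x e.1.1) (x e.1.2)) := by
        intro e
        split_ifs
        · exact le_rfl
        · exact indT_nonneg _ _ _ _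
      have hp0 : 0 ≤ (∏ e : Edge N, W (c e) (x e.1.1) (x e.1.2)) / η ^ r :=
        div_nonneg (Finset.prod_nonneg fun _ _ => hW0 _ _ _) (by positivity)
      by_cases hall : ∀ e : Edge N, η ≤ W (c e) (x e.1.1) (x e.1.2)
      · have a1 : ∏ e : Edge N, indT t' (c e) (x e.1.1) (x e.1.2) ≤ 1 :=
          Finset.prod_le_one (fun _ _ => indT_nonneg _ _ _ _) fun _ _ => indT_le_one _ _ _ _
        have a2 : 1 ≤ (∏ e : Edge N, W (c e) (x e.1.1) (x e.1.2)) / η ^ r := by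
          rw [le_div_iff₀ (by positivity), one_mul]
          calc η ^ r = ∏ e : Edge N, η := by rw [Finset.prod_const, Finset.card_univ]
            _ ≤ _ := Finset.prod_le_prod (fun _ _ => hη.le) fun e _ => hall e
        have := Finset.sum_nonneg fun (e : Edge N) (_ : e ∈ univ) => hs0 e
        linarith
      · push Not at hall
        obtain ⟨e, he⟩ := hall
        by_cases hz : ∏ e : Edge N, indT t' (c e) (x e.1.1) (x e.1.2) = 0
        · rw [hz]
          exact add_nonneg hp0 (Finset.sum_nonneg fun e _ => hs0 e)
        · obtain ⟨hx, hre⟩ := prod_ind_realise t' c x hz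
          have a1 : ∏ e : Edge N, indT t' (c e) (x e.1.1) (x e.1.2) ≤ 1 :=
            Finset.prod_le_one (fun _ _ => indT_nonneg _ _ _ _) fun _ _ => indT_le_one _ _ _ _
          have a2 : c e ∈ t (Edge.map x hx e) := hcov _ _ (hre e) (not_le.2 he)
          have a3 : indT t (c e) (x e.1.1) (x e.1.2) = 1 := by
            unfold indT
            rw [if_pos ⟨hx e.2, a2⟩]
          have a4 := Finset.single_le_sum (fun e _ => hs0 e) (Finset.mem_univ e)
          rw [if_neg (not_le.2 he), a3] at a4
          linarith
    have h2 : ∑ x : Fin N → Fin n, ∏ e : Edge N, W (c e) (x e.1.1) (x e.1.2) ≤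
        r * γ * (n : ℝ) ^ N := by
      have := count_main (N := N) hn γ (fun e => indT t (c e)) (fun e => W (c e))
        (fun _ _ _ => indT_nonneg _ _ _ _) (fun _ _ _ => indT_le_one _ _ _ _)
        (fun _ _ _ => hW0 _ _ _) (fun _ _ _ => hW1 _ _ _) (fun e => hcut (c e))
      refine this.trans (le_of_eq ?_)
      rw [Finset.sum_eq_zero, zero_add]
      intro x _
      by_contra hz
      obtain ⟨hx, hre⟩ := prod_ind_realise t c x hz
      exact hc (no_bad P hP t ht hsub x hx c hre)
    have h3 : ∀ e : Edge N, ∑ x : Fin N → Fin n, (if η ≤ W (c e) (x e.1.1) (x e.1.2) then 0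
          else indT t (c e) (x e.1.1) (x e.1.2)) ≤ η * (n : ℝ) ^ N := by
      intro e
      have hn2 : (0 : ℝ) < (n : ℝ) ^ 2 := by positivity
      refine le_of_mul_le_mul_left ?_ hn2
      have h := sum_update2 (X := Fin n) e.1.1 e.1.2
        (fun x : Fin N → Fin n => (if η ≤ W (c e) (x e.1.1) (x e.1.2) then 0
          else indT t (c e) (x e.1.1) (x e.1.2)))
      rw [Fintype.card_fin] at h
      rw [← h]
      have hab : e.1.1 ≠ e.1.2 := ne_of_lt e.2
      simp only [Function.update_self, Function.update_of_ne hab]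
      calc _ ≤ ∑ x : Fin N → Fin n, η * (n : ℝ) ^ 2 := Finset.sum_le_sum fun x _ => hlow (c e)
        _ = _ := by simp; ring
    calc _ ≤ _ := Finset.sum_le_sum fun x _ => h1 x
      _ = (∑ x : Fin N → Fin n, ∏ e : Edge N, W (c e) (x e.1.1) (x e.1.2)) / η ^ r +
        ∑ e : Edge N, ∑ x : Fin N → Fin n, (if η ≤ W (c e) (x e.1.1) (x e.1.2) then 0
          else indT t (c e) (x e.1.1) (x e.1.2)) := by
          rw [Finset.sum_add_distrib, Finset.sum_div, Finset.sum_comm (s := univ (α := Edge N))]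
      _ ≤ (r * γ * (n : ℝ) ^ N) / η ^ r + ∑ e : Edge N, η * (n : ℝ) ^ N := by
          gcongr
          exact h3 _
      _ = _ := by
          rw [Finset.sum_const, Finset.card_univ, nsmul_eq_mul]
          ring
  have hle : (badPairs t' (P N)ᶜ : ℝ) ≤ ∑ c : Colouring k N, if c ∈ P N then 0 else
      ∑ x : Fin N → Fin n, ∏ e : Edge N, indT t' (c e) (x e.1.1) (x e.1.2) := by
    have e1 : {p : (Fin N → Fin n) × Colouring k N |
        ∃ h : StrictMono p.1, p.2 ∈ (P N)ᶜ ∧ Realises p.2 (restrictT t' p.1 h)} =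
        ((univ.filter (fun p : (Fin N → Fin n) × Colouring k N =>
          ∃ h : StrictMono p.1, p.2 ∈ (P N)ᶜ ∧ Realises p.2 (restrictT t' p.1 h)) :
          Finset ((Fin N → Fin n) × Colouring k N)) : Set ((Fin N → Fin n) × Colouring k N)) := by
      ext p; simp
    unfold badPairs
    rw [e1, Set.ncard_coe_finset, Finset.card_filter]
    push_cast
    rw [Fintype.sum_prod_type, Finset.sum_comm]
    refine Finset.sum_le_sum fun c _ => ?_
    by_cases hc : c ∈ P N
    · rw [if_pos hc]
      refine le_of_eq (Finset.sum_eq_zero fun x _ => ?_)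
      rw [if_neg]
      rintro ⟨_, h, _⟩
      exact h hc
    · rw [if_neg hc]
      refine Finset.sum_le_sum fun x _ => ?_
      split_ifs with hh
      · obtain ⟨h, _, h2⟩ := hh
        refine le_of_eq (Finset.prod_eq_one fun e _ => ?_).symm
        unfold indT
        rw [if_pos ⟨h e.2, h2 e⟩]
      · exact Finset.prod_nonneg fun _ _ => indT_nonneg _ _ _ _
  refine hle.trans ?_
  calc _ ≤ ∑ c : Colouring k N, (r * γ / η ^ r + r * η) * (n : ℝ) ^ N := by
        refine Finset.sum_le_sum fun c _ => ?_
        split_ifs with hc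
        · positivity
        · exact percol c hc
    _ = _ := by
        rw [Finset.sum_const, Finset.card_univ, nsmul_eq_mul, Fintype.card_fun, Fintype.card_fin]
        push_cast
        ring

end Bad
section EntBound
open Finset

lemma card_edge (N : ℕ) : Fintype.card (Edge N) = N.choose 2 := by
  classical
  rw [Fintype.card_subtype, Finset.card_filter, Fintype.sum_prod_type_right]
  have : ∀ y : Fin N, (∑ x : Fin N, if (x, y).1 < (x, y).2 then 1 else 0) = (y : ℕ) := by
    intro y
    rw [← Finset.card_filter]
    have : (univ.filter fun x : Fin N => (x, y).1 < (x, y).2) = Finset.Iio y := by ext; simp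
    rw [this, Fin.card_Iio]
  simp_rw [this]
  rw [Fin.sum_univ_eq_sum_range (fun i => i) N, Finset.sum_range_id, Nat.choose_two_right]

lemma logb_card_nonneg {k : ℕ} (hk : 2 ≤ k) (s : Finset (Fin k)) : 0 ≤ Real.logb k (#s) := by
  rcases Nat.eq_zero_or_pos (#s) with h | h
  · simp [h]
  · exact Real.logb_nonneg (by exact_mod_cast hk) (by exact_mod_cast h)

lemma logb_card_le_one {k : ℕ} (hk : 2 ≤ k) (s : Finset (Fin k)) : Real.logb k (#s) ≤ 1 := by
  rcases Nat.eq_zero_or_pos (#s) with h | h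
  · simp [h]
  · have hk1 : (1 : ℝ) < k := by exact_mod_cast hk
    rw [← Real.logb_self_eq_one hk1]
    refine Real.logb_le_logb_of_le hk1 (by exact_mod_cast h) ?_
    have := Finset.card_le_univ s
    rw [Fintype.card_fin] at this
    exact_mod_cast this

lemma Ent_nonneg {k n : ℕ} (hk : 2 ≤ k) (t : Template k n) : 0 ≤ Ent t :=
  Finset.sum_nonneg fun _ _ => logb_card_nonneg hk _

lemma Ent_le {k n : ℕ} (hk : 2 ≤ k) (t : Template k n) : Ent t ≤ n.choose 2 := by
  rw [← card_edge]
  calc Ent t ≤ ∑ e : Edge n, (1 : ℝ) := Finset.sum_le_sum fun _ _ => logb_card_le_one hk _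
    _ = _ := by simp

lemma le_exEnt {k n : ℕ} (hk : 2 ≤ k) (A : Set (Colouring k n)) (t : Template k n)
    (ht : Proper t) (h : ∀ c, Realises c t → c ∈ A) : Ent t ≤ exEnt A := by
  refine le_csSup ⟨n.choose 2, ?_⟩ ⟨t, ht, h, rfl⟩
  rintro x ⟨t, _, _, rfl⟩
  exact Ent_le hk t

lemma exEnt_nonneg {k n : ℕ} (hk : 2 ≤ k) (A : Set (Colouring k n)) : 0 ≤ exEnt A := by
  refine Real.sSup_nonneg ?_
  rintro x ⟨t, _, _, rfl⟩
  exact Ent_nonneg hk t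

lemma card_pair_super {n N : ℕ} (hN : 2 ≤ N) (x y : Fin n) (hxy : x ≠ y) :
    #((powersetCard N (univ : Finset (Fin n))).filter (fun A => x ∈ A ∧ y ∈ A))
      = (n - 2).choose (N - 2) := by
  have hc : #({x, y} : Finset (Fin n)) = 2 := Finset.card_pair hxy
  have h2 : #((univ : Finset (Fin n)) \ {x, y}) = n - 2 := by
    rw [Finset.card_sdiff_of_subset (Finset.subset_univ _), hc]; simp
  rw [← h2, ← Finset.card_powersetCard]
  refine Finset.card_nbij' (fun A => A \ {x, y}) (fun B => B ∪ {x, y}) ?_ ?_ ?_ ?_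
  · intro A hA
    simp only [Finset.coe_filter, Finset.mem_powersetCard, Set.mem_ofPred_eq] at hA
    have hs : ({x, y} : Finset (Fin n)) ⊆ A := by
      intro z hz
      simp only [Finset.mem_insert, Finset.mem_singleton] at hz
      rcases hz with rfl | rfl
      · exact hA.2.1
      · exact hA.2.2
    simp only [Finset.mem_coe, Finset.mem_powersetCard]
    refine ⟨Finset.sdiff_subset_sdiff (Finset.subset_univ _) (Finset.Subset.refl _), ?_⟩
    rw [Finset.card_sdiff_of_subset hs, hc, hA.1.2]
  · intro B hB
    simp only [Finset.mem_coe, Finset.mem_powersetCard] at hB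
    simp only [Finset.coe_filter, Finset.mem_powersetCard, Set.mem_ofPred_eq]
    refine ⟨⟨Finset.subset_univ _, ?_⟩, by simp, by simp⟩
    rw [Finset.card_union_of_disjoint, hB.2, hc]
    · omega
    · exact Finset.disjoint_of_subset_left hB.1 Finset.sdiff_disjoint
  · intro A hA
    simp only [Finset.coe_filter, Finset.mem_powersetCard, Set.mem_ofPred_eq] at hA
    have hs : ({x, y} : Finset (Fin n)) ⊆ A := by
      intro z hz
      simp only [Finset.mem_insert, Finset.mem_singleton] at hz
      rcases hz with rfl | rfl
      · exact hA.2.1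
      · exact hA.2.2
    exact Finset.sdiff_union_of_subset hs
  · intro B hB
    simp only [Finset.mem_coe, Finset.mem_powersetCard] at hB
    have : Disjoint B {x, y} := Finset.disjoint_of_subset_left hB.1 Finset.sdiff_disjoint
    exact Finset.union_sdiff_cancel_right this

lemma ent_restrict {k n N : ℕ} (t : Template k n) (A : Finset (Fin n)) (hA : #A = N) :
    Ent (restrictT t (A.orderEmbOfFin hA) (A.orderEmbOfFin hA).strictMono) =
      ∑ e : Edge n, if e.1.1 ∈ A ∧ e.1.2 ∈ A then Real.logb k (#(t e)) else 0 := by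
  rw [← Finset.sum_filter]
  unfold Ent
  refine Finset.sum_nbij (Edge.map (A.orderEmbOfFin hA) (A.orderEmbOfFin hA).strictMono) ?_ ?_ ?_ ?_
  · intro e _
    simp [Edge.map]
  · exact (Edge.map_injective _ _).injOn
  · intro e he
    simp only [Finset.coe_filter, Finset.mem_univ, true_and, Set.mem_ofPred_eq] at he
    have hr := Finset.range_orderEmbOfFin A hA
    obtain ⟨i, hi⟩ : e.1.1 ∈ Set.range (A.orderEmbOfFin hA) := by rw [hr]; exact he.1
    obtain ⟨j, hj⟩ : e.1.2 ∈ Set.range (A.orderEmbOfFin hA) := by rw [hr]; exact he.2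
    have hij : i < j := by
      rw [← (A.orderEmbOfFin hA).lt_iff_lt, hi, hj]
      exact e.2
    exact ⟨⟨(i, j), hij⟩, by simp, Subtype.ext (Prod.ext hi hj)⟩
  · intro e _
    rfl

lemma ent_bound {k n N : ℕ} (hk : 2 ≤ k) (hN : 2 ≤ N) (hNn : N ≤ n)
    (P : Set (Colouring k N)) (t : Template k n) (ht : Proper t) (α δ : ℝ)
    (hα : exEnt P ≤ α * (N.choose 2 : ℝ))
    (hbad : (badPairs t Pᶜ : ℝ) ≤ δ * (n.choose N : ℝ)) :
    Ent t ≤ (α + δ) * (n.choose 2 : ℝ) := by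
  classical
  set w : Edge n → ℝ := fun e => Real.logb k (#(t e)) with hw
  set 𝒜 := powersetCard N (univ : Finset (Fin n)) with h𝒜
  have hcard𝒜 : #𝒜 = n.choose N := by rw [h𝒜, Finset.card_powersetCard]; simp
  set E : Finset (Fin n) → ℝ := fun A => ∑ e : Edge n, if e.1.1 ∈ A ∧ e.1.2 ∈ A then w e else 0
    with hE
  have hdc : ∑ A ∈ 𝒜, E A = ((n - 2).choose (N - 2) : ℝ) * Ent t := by
    simp only [hE]
    rw [Finset.sum_comm]
    unfold Ent
    rw [Finset.mul_sum]
    refine Finset.sum_congr rfl fun e _ => ?_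
    rw [← Finset.sum_filter, Finset.sum_const, nsmul_eq_mul,
      card_pair_super hN e.1.1 e.1.2 (ne_of_lt e.2)]
  let isBad : Finset (Fin n) → Prop := fun A => ∃ (hA : #A = N) (c : Colouring k N), c ∉ P ∧
    Realises c (restrictT t (A.orderEmbOfFin hA) (A.orderEmbOfFin hA).strictMono)
  have hnb : (#(𝒜.filter isBad) : ℝ) ≤ badPairs t Pᶜ := by
    unfold badPairs
    rw [Nat.cast_le, ← Set.ncard_coe_finset]
    refine Set.ncard_le_ncard_of_injOn
      (fun A => if h : isBad A then (((A.orderEmbOfFin h.choose : Fin N → Fin n)),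
        h.choose_spec.choose) else ((fun _ => ⟨0, by omega⟩), fun _ => ⟨0, by omega⟩)) ?_ ?_
      (Set.toFinite _)
    · intro A hA
      have hA' : isBad A := (Finset.mem_filter.1 (Finset.mem_coe.1 hA)).2
      simp only [hA', dif_pos]
      exact ⟨_, hA'.choose_spec.choose_spec.1, hA'.choose_spec.choose_spec.2⟩
    · intro A hA B hB hAB
      have hA' : isBad A := (Finset.mem_filter.1 (Finset.mem_coe.1 hA)).2
      have hB' : isBad B := (Finset.mem_filter.1 (Finset.mem_coe.1 hB)).2
      simp only [hA', hB', dif_pos] at hAB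
      have h1 := (Prod.ext_iff.1 hAB).1
      have h2 : Set.range (A.orderEmbOfFin hA'.choose : Fin N → Fin n)
          = Set.range (B.orderEmbOfFin hB'.choose : Fin N → Fin n) := congrArg Set.range h1
      rw [Finset.range_orderEmbOfFin, Finset.range_orderEmbOfFin] at h2
      exact_mod_cast h2
  have hEA : ∀ A ∈ 𝒜, E A ≤ exEnt P + if isBad A then (N.choose 2 : ℝ) else 0 := by
    intro A hA
    have hAN : #A = N := (Finset.mem_powersetCard.1 hA).2
    have hEe : E A = _ := (ent_restrict t A hAN).symm
    rw [hEe]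
    split_ifs with hb
    · have := Ent_le hk (restrictT t (A.orderEmbOfFin hAN) (A.orderEmbOfFin hAN).strictMono)
      have := exEnt_nonneg hk P
      linarith
    · rw [add_zero]
      refine le_exEnt hk P _ (fun e => ht _) fun c hc => ?_
      by_contra hcon
      exact hb ⟨hAN, c, hcon, hc⟩
  have hsum : ((n - 2).choose (N - 2) : ℝ) * Ent t ≤
      (n.choose N : ℝ) * exEnt P + badPairs t Pᶜ * (N.choose 2 : ℝ) := by
    rw [← hdc]
    refine (Finset.sum_le_sum hEA).trans ?_
    rw [Finset.sum_add_distrib, Finset.sum_const, nsmul_eq_mul, hcard𝒜, ← Finset.sum_filter,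
      Finset.sum_const, nsmul_eq_mul]
    gcongr
  have hid : (n.choose N : ℝ) * (N.choose 2 : ℝ) = (n.choose 2 : ℝ) * ((n - 2).choose (N - 2) : ℝ) := by
    exact_mod_cast Nat.choose_mul (n := n) hN
  have hpos : (0 : ℝ) < ((n - 2).choose (N - 2) : ℝ) := by
    exact_mod_cast Nat.choose_pos (by omega)
  refine le_of_mul_le_mul_left ?_ hpos
  calc _ ≤ _ := hsum
    _ ≤ (n.choose N : ℝ) * (α * (N.choose 2 : ℝ)) + δ * (n.choose N : ℝ) * (N.choose 2 : ℝ) := by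
        gcongr
    _ = (α + δ) * ((n.choose N : ℝ) * (N.choose 2 : ℝ)) := by ring
    _ = _ := by rw [hid]; ring

end EntBound

section Data
open Finset

lemma card_small_sets (V : Type*) [Fintype V] (x : ℝ) (hx : 0 < x) (hx1 : x ≤ 1)
    (s : ℝ) : (Fintype.card {S : Finset V // (#S : ℝ) ≤ s} : ℝ)
      ≤ Real.exp (x * Fintype.card V + s * Real.log (1 / x)) := by
  classical
  have hL : 0 ≤ Real.log (1 / x) := Real.log_nonneg (by rw [le_div_iff₀ hx]; linarith)
  rw [Fintype.card_subtype, Finset.card_filter]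
  push_cast
  have h1 : ∀ S : Finset V, (if (#S : ℝ) ≤ s then (1 : ℝ) else 0) ≤
      x ^ #S * Real.exp (s * Real.log (1 / x)) := by
    intro S
    split_ifs with h
    · have : x ^ #S = Real.exp (-(#S * Real.log (1 / x))) := by
        rw [one_div, Real.log_inv, mul_neg, neg_neg, Real.exp_nat_mul, Real.exp_log hx]
      rw [this, ← Real.exp_add]
      refine Real.one_le_exp ?_
      nlinarith
    · positivity
  have h2 : ∑ S : Finset V, x ^ #S = (x + 1) ^ Fintype.card V := by
    have := Fintype.sum_pow_mul_eq_add_pow V x 1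
    simpa using this
  calc _ ≤ ∑ S : Finset V, x ^ #S * Real.exp (s * Real.log (1 / x)) := Finset.sum_le_sum fun S _ => h1 S
    _ = (x + 1) ^ Fintype.card V * Real.exp (s * Real.log (1 / x)) := by rw [← Finset.sum_mul, h2]
    _ ≤ Real.exp x ^ Fintype.card V * Real.exp (s * Real.log (1 / x)) := by
        gcongr
        exact Real.add_one_le_exp x
    _ = _ := by rw [← Real.exp_nat_mul, ← Real.exp_add]; congr 1; ring

lemma choose_lower (s n : ℕ) (h : 2 * s ≤ n) :
    (n : ℝ) ^ s ≤ 2 ^ s * s.factorial * (n.choose s : ℝ) := by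
  have h1 := Nat.pow_le_choose (α := ℝ) s n
  rw [div_le_iff₀ (by positivity)] at h1
  have h2 : (n : ℝ) / 2 ≤ ((n + 1 - s : ℕ) : ℝ) := by
    rw [Nat.cast_sub (by omega)]
    push_cast
    have : (2 : ℝ) * s ≤ n := by exact_mod_cast h
    linarith
  calc (n : ℝ) ^ s = 2 ^ s * ((n : ℝ) / 2) ^ s := by rw [← mul_pow]; congr 1; ring
    _ ≤ 2 ^ s * ((n + 1 - s : ℕ) : ℝ) ^ s := by gcongr
    _ ≤ 2 ^ s * ((n.choose s : ℝ) * s.factorial) := by gcongr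
    _ = _ := by ring

lemma exists_small (a b : ℝ) (ha : 0 ≤ a) (hb : 0 < b) :
    ∃ η₀ : ℝ, 0 < η₀ ∧ ∀ η, 0 < η → η ≤ η₀ → a * η ≤ b := by
  refine ⟨b / (a + 1), by positivity, fun η h0 h1 => ?_⟩
  rw [le_div_iff₀ (by positivity)] at h1
  nlinarith

end Data
section Assemble
open Finset

/-- data encoding a container -/
abbrev CData (k n K : ℕ) (s : ℝ) :=
  (Fin k → (Fin n → Fin K) × (Fin n → Fin K) × Finset (Fin K × Fin K)) ×
    {S : Finset (Edge n × Fin k) // (#S : ℝ) ≤ s}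

/-- the container encoded by the data -/
def decodeC {k n K : ℕ} {s : ℝ} (d : CData k n K s) : Template k n := fun e =>
  univ.filter (fun i => ((d.1 i).1 e.1.1, (d.1 i).2.1 e.1.2) ∈ (d.1 i).2.2 ∨ (e, i) ∈ d.2.1)

lemma card_CData (k n K : ℕ) (hn : 0 < n) (hK : 0 < K) (s x : ℝ) (hx : 0 < x) (hx1 : x ≤ 1) :
    (Fintype.card (CData k n K s) : ℝ) ≤
      Real.exp (n * (k * (2 * Real.log K + K * K * Real.log 2))
        + (x * (k * n.choose 2) + s * Real.log (1 / x))) := by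
  classical
  have h1 := card_small_sets (Edge n × Fin k) x hx hx1 s
  rw [Fintype.card_prod, card_edge, Fintype.card_fin] at h1
  rw [Fintype.card_prod, Nat.cast_mul, Real.exp_add]
  have hK' : (0 : ℝ) < K := by exact_mod_cast hK
  have hn' : (1 : ℝ) ≤ n := by exact_mod_cast hn
  refine mul_le_mul ?_ ?_ (by positivity) (by positivity)
  · simp only [Fintype.card_fun, Fintype.card_prod, Fintype.card_fin, Fintype.card_finset]
    push_cast
    have e1 : ((K : ℝ) ^ n * ((K : ℝ) ^ n * 2 ^ (K * K))) ^ k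
        = Real.exp (k * (2 * n * Real.log K + K * K * Real.log 2)) := by
      rw [Real.exp_nat_mul]
      congr 1
      have a1 : (K : ℝ) ^ n = Real.exp (n * Real.log K) := by
        rw [Real.exp_nat_mul, Real.exp_log hK']
      have a2 : (2 : ℝ) ^ (K * K) = Real.exp (((K * K : ℕ) : ℝ) * Real.log 2) := by
        rw [Real.exp_nat_mul, Real.exp_log (by norm_num)]
      rw [a1, a2, ← Real.exp_add, ← Real.exp_add]
      congr 1
      push_cast
      ring
    rw [e1]
    refine Real.exp_le_exp.2 ?_
    have hl : 0 ≤ (K : ℝ) * K * Real.log 2 := mul_nonneg (by positivity) (Real.log_nonneg (by norm_num))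
    have : 2 * n * Real.log K + K * K * Real.log 2 ≤ n * (2 * Real.log K + K * K * Real.log 2) := by
      nlinarith
    calc _ ≤ (k : ℝ) * (n * (2 * Real.log K + K * K * Real.log 2)) := by gcongr
      _ = _ := by ring
  · refine h1.trans (Real.exp_le_exp.2 ?_)
    push_cast
    apply le_of_eq
    ring

lemma exists_data {k n K : ℕ} (η γ : ℝ)
    (hfk : ∀ f : Fin n → Fin n → ℝ, (∀ x y, 0 ≤ f x y) → (∀ x y, f x y ≤ 1) →
    ∃ (p q : Fin n → Fin K) (H : Finset (Fin K × Fin K)) (W : Fin n → Fin n → ℝ),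
      (∀ x y, 0 ≤ W x y) ∧ (∀ x y, W x y ≤ 1) ∧
      (∀ u v : Fin n → ℝ, (∀ x, 0 ≤ u x) → (∀ x, u x ≤ 1) → (∀ x, 0 ≤ v x) → (∀ x, v x ≤ 1) →
        ∑ x, ∑ y, (W x y - f x y) * (u x * v y) ≤ γ * (n : ℝ) ^ 2) ∧
      (∀ x y, (p x, q y) ∈ H ↔ η ≤ W x y) ∧
      ∑ x, ∑ y, (if η ≤ W x y then 0 else f x y) ≤ η * (n : ℝ) ^ 2)
    (t : Template k n) :
    ∃ (d : CData k n K (k * η * (n : ℝ) ^ 2)) (W : Fin k → Fin n → Fin n → ℝ),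
      (∀ i x y, 0 ≤ W i x y) ∧ (∀ i x y, W i x y ≤ 1) ∧
      (∀ i, ∀ u v : Fin n → ℝ, (∀ x, 0 ≤ u x) → (∀ x, u x ≤ 1) →
        (∀ x, 0 ≤ v x) → (∀ x, v x ≤ 1) →
        ∑ x, ∑ y, (W i x y - indT t i x y) * (u x * v y) ≤ γ * (n : ℝ) ^ 2) ∧
      (∀ i, ∑ x, ∑ y, (if η ≤ W i x y then 0 else indT t i x y) ≤ η * (n : ℝ) ^ 2) ∧
      (∀ e i, i ∈ decodeC d e → ¬ η ≤ W i e.1.1 e.1.2 → i ∈ t e) ∧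
      ∀ e, t e ⊆ decodeC d e := by
  classical
  choose p q H W hW0 hW1 hcut hH hlow using
    fun i : Fin k => hfk (indT t i) (indT_nonneg t i) (indT_le_one t i)
  have hS : (#(univ.filter (fun z : Edge n × Fin k => z.2 ∈ t z.1 ∧
      ¬ η ≤ W z.2 z.1.1.1 z.1.1.2)) : ℝ) ≤ k * η * (n : ℝ) ^ 2 := by
    rw [Finset.card_filter]
    push_cast
    rw [Fintype.sum_prod_type_right]
    calc _ ≤ ∑ i : Fin k, η * (n : ℝ) ^ 2 := by
          refine Finset.sum_le_sum fun i _ => le_trans ?_ (hlow i)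
          rw [← Fintype.sum_prod_type' (f := fun x y => if η ≤ W i x y then 0 else indT t i x y)]
          calc _ ≤ ∑ e : Edge n, (fun z : Fin n × Fin n =>
                if η ≤ W i z.1 z.2 then 0 else indT t i z.1 z.2) e.1 := by
                refine Finset.sum_le_sum fun e _ => ?_
                dsimp only
                by_cases h1 : η ≤ W i e.1.1 e.1.2
                · simp [h1]
                · rw [if_neg h1]
                  split_ifs with h2
                  · unfold indT
                    rw [if_pos ⟨e.2, h2.1⟩]
                  · exact indT_nonneg _ _ _ _
            _ = ∑ z ∈ univ.map (Function.Embedding.subtype (fun p : Fin n × Fin n => p.1 < p.2)),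
                (if η ≤ W i z.1 z.2 then 0 else indT t i z.1 z.2) := by
                rw [Finset.sum_map]
                rfl
            _ ≤ _ := by
                refine Finset.sum_le_sum_of_subset_of_nonneg (Finset.subset_univ _) fun z _ _ => ?_
                split_ifs
                · exact le_rfl
                · exact indT_nonneg _ _ _ _
      _ = _ := by simp; ring
  refine ⟨⟨fun i => (p i, q i, H i), ⟨_, hS⟩⟩, W, hW0, hW1, hcut, hlow, ?_, ?_⟩
  · intro e i hi hn
    simp only [decodeC, Finset.mem_filter, Finset.mem_univ, true_and, hH] at hi
    rcases hi with h | h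
    · exact absurd h hn
    · exact h.1
  · intro e i hi
    simp only [decodeC, Finset.mem_filter, Finset.mem_univ, true_and, hH]
    by_cases h : η ≤ W i e.1.1 e.1.2
    · exact Or.inl h
    · exact Or.inr ⟨hi, h⟩

lemma bad_numeric (k s : ℕ) (δ : ℝ) (hδ : 0 < δ) : ∃ η₀ : ℝ, 0 < η₀ ∧ ∀ η, 0 < η → η ≤ η₀ →
    ∃ γ₀ : ℝ, 0 < γ₀ ∧ ∀ γ, 0 < γ → γ ≤ γ₀ → ∀ n : ℕ, 2 * s ≤ n →
      (k : ℝ) ^ Fintype.card (Edge s) *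
      (Fintype.card (Edge s) * γ / η ^ Fintype.card (Edge s) + Fintype.card (Edge s) * η)
        * (n : ℝ) ^ s ≤ δ * (n.choose s : ℝ) := by
  set r := Fintype.card (Edge s)
  set Q : ℝ := 2 ^ s * s.factorial with hQ
  obtain ⟨η₀, h0, h1⟩ := exists_small ((k : ℝ) ^ r * r * Q) (δ / 2) (by positivity) (by positivity)
  refine ⟨η₀, h0, fun η hη hη0 => ?_⟩
  obtain ⟨γ₀, g0, g1⟩ := exists_small ((k : ℝ) ^ r * r * Q / η ^ r) (δ / 2) (by positivity) (by positivity)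
  refine ⟨γ₀, g0, fun γ hγ hγ0 n hn => ?_⟩
  have a1 := h1 η hη hη0
  have a2 := g1 γ hγ hγ0
  calc _ ≤ (k : ℝ) ^ r * (r * γ / η ^ r + r * η) * (Q * (n.choose s : ℝ)) := by
        gcongr
        exact choose_lower s n hn
    _ = ((k : ℝ) ^ r * r * Q / η ^ r * γ + (k : ℝ) ^ r * r * Q * η) * (n.choose s : ℝ) := by ring
    _ ≤ _ := by
        gcongr
        linarith

end Assemble

/-- Containers for general order-hereditary properties (Corollary 2.16). -/
theorem containers_for_hereditary (k : ℕ) (hk : 2 ≤ k)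
    (P : ∀ n, Set (Colouring k n)) (hP : OrderHereditary P)
    (hne : ∀ n, (P n).Nonempty) (π : ℝ)
    (hπ : Tendsto (fun n => exEnt (P n) / (n.choose 2 : ℝ)) atTop (nhds π))
    (ε : ℝ) (hε : 0 < ε) (m : ℕ) :
    ∃ n₀ : ℕ, ∀ n, n₀ ≤ n → ∃ T : Finset (Template k n),
      (∀ t ∈ T, Proper t) ∧
      IsContainerFamily T (P n) ∧
      (∀ t ∈ T, Ent t ≤ (π + ε) * (n.choose 2 : ℝ)) ∧
      (∀ t ∈ T, (badPairs t ((P m)ᶜ) : ℝ) ≤ ε * (n.choose m : ℝ)) ∧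
      (T.card : ℝ) ≤ (k : ℝ) ^ (ε * (n.choose 2 : ℝ)) := by
  classical
  -- choice of N
  obtain ⟨N, hN2, hNπ⟩ : ∃ N : ℕ, 2 ≤ N ∧ exEnt (P N) ≤ (π + ε / 2) * (N.choose 2 : ℝ) := by
    have h1 : ∀ᶠ n in atTop, exEnt (P n) / (n.choose 2 : ℝ) < π + ε / 2 :=
      hπ.eventually (gt_mem_nhds (by linarith))
    obtain ⟨N, hN, h2⟩ := (h1.and (eventually_ge_atTop 2)).exists
    refine ⟨N, h2, ?_⟩
    have hpos : (0 : ℝ) < (N.choose 2 : ℝ) := by exact_mod_cast Nat.choose_pos h2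
    rw [div_lt_iff₀ hpos] at hN
    exact hN.le
  have hk0 : (0 : ℝ) < k := by positivity
  have hk1 : (1 : ℝ) < k := by exact_mod_cast hk
  set τ := ε * Real.log k with hτ
  have hτ0 : 0 < τ := mul_pos hε (Real.log_pos hk1)
  set x := min 1 (τ / (3 * k)) with hx
  have hx0 : 0 < x := lt_min one_pos (by positivity)
  have hx1 : x ≤ 1 := min_le_left _ _
  have hxk : x * k ≤ τ / 3 := by
    have : x ≤ τ / (3 * k) := min_le_right _ _
    rw [le_div_iff₀ (by positivity)] at this
    linarith
  set Lg := Real.log (1 / x) with hLg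
  have hLg0 : 0 ≤ Lg := Real.log_nonneg (by rw [le_div_iff₀ hx0]; linarith)
  obtain ⟨η₁, hη₁, H1⟩ := bad_numeric k m (ε / 2) (by positivity)
  obtain ⟨η₂, hη₂, H2⟩ := bad_numeric k N (ε / 2) (by positivity)
  obtain ⟨η₃, hη₃, H3⟩ := exists_small (4 * k * Lg) (τ / 3) (by positivity) (by positivity)
  set η := min η₁ (min η₂ η₃) with hηdef
  have hη : 0 < η := lt_min hη₁ (lt_min hη₂ hη₃)
  obtain ⟨γ₁, hγ₁, G1⟩ := H1 η hη (min_le_left _ _)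
  obtain ⟨γ₂, hγ₂, G2⟩ := H2 η hη ((min_le_right _ _).trans (min_le_left _ _))
  have H3' := H3 η hη ((min_le_right _ _).trans (min_le_right _ _))
  set γ := min γ₁ γ₂ with hγdef
  have hγ : 0 < γ := lt_min hγ₁ hγ₂
  have G1' := G1 γ hγ (min_le_left _ _)
  have G2' := G2 γ hγ (min_le_right _ _)
  obtain ⟨K, hK, hfk⟩ := fk_main γ η hγ hη
  set R : ℝ := k * (2 * Real.log K + K * K * Real.log 2) with hR
  obtain ⟨n₁, hn₁⟩ := exists_nat_ge (12 * R / τ)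
  refine ⟨n₁ + 2 * m + 2 * N + 2, fun n hn => ?_⟩
  have hn0 : 0 < n := by omega
  have hC : (n : ℝ) ^ 2 ≤ 4 * (n.choose 2 : ℝ) := by
    rw [Nat.cast_choose_two]
    have : (2 : ℝ) ≤ n := by exact_mod_cast (by omega : 2 ≤ n)
    nlinarith
  let Q : Template k n → Prop := fun t => Proper t ∧
    Ent t ≤ (π + ε) * (n.choose 2 : ℝ) ∧ (badPairs t ((P m)ᶜ) : ℝ) ≤ ε * (n.choose m : ℝ)
  refine ⟨((Finset.univ : Finset (CData k n K (k * η * (n : ℝ) ^ 2))).image decodeC).filter Q,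
    fun t ht => (Finset.mem_filter.1 ht).2.1, ?_, fun t ht => (Finset.mem_filter.1 ht).2.2.1,
    fun t ht => (Finset.mem_filter.1 ht).2.2.2, ?_⟩
  · intro t ht hsub
    obtain ⟨d, W, hW0, hW1, hcut, hlow, hcov, hle⟩ := exists_data η γ (hfk n hn0) t
    have hprop : Proper (decodeC d) := fun e => (ht e).mono (hle e)
    have hb1 := bad_bound (N := m) hn0 P hP t ht hsub (decodeC d) η γ hη hγ W hW0 hW1 hcut hlow hcov
    have hb2 := bad_bound (N := N) hn0 P hP t ht hsub (decodeC d) η γ hη hγ W hW0 hW1 hcut hlow hcov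
    have hb1' := hb1.trans (G1' n (by omega))
    have hb2' := hb2.trans (G2' n (by omega))
    have hent := ent_bound hk hN2 (by omega) (P N) (decodeC d) hprop _ _ hNπ hb2'
    refine ⟨decodeC d, Finset.mem_filter.2 ⟨Finset.mem_image_of_mem _ (Finset.mem_univ d), hprop, ?_, ?_⟩,
      id, strictMono_id, fun e => hle e⟩
    · refine hent.trans (le_of_eq ?_)
      ring
    · refine hb1'.trans ?_
      gcongr
      linarith
  · have c1 : (((Finset.univ : Finset (CData k n K (k * η * (n : ℝ) ^ 2))).image decodeC).filter Q).card
        ≤ Fintype.card (CData k n K (k * η * (n : ℝ) ^ 2)) :=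
      (Finset.card_filter_le _ _).trans Finset.card_image_le
    have c2 := card_CData k n K hn0 hK (k * η * (n : ℝ) ^ 2) x hx0 hx1
    refine le_trans (by exact_mod_cast c1) (c2.trans ?_)
    rw [Real.rpow_def_of_pos hk0]
    refine Real.exp_le_exp.2 ?_
    have hn1 : 12 * R ≤ n * τ := by
      rw [div_le_iff₀ hτ0] at hn₁
      have : (n₁ : ℝ) ≤ n := by exact_mod_cast (by omega : n₁ ≤ n)
      nlinarith
    have hnpos : (0 : ℝ) < n := by exact_mod_cast hn0
    set C : ℝ := (n.choose 2 : ℝ) with hCdef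
    have hC0 : 0 ≤ C := by positivity
    have t1 : n * R ≤ τ / 3 * C := by
      have : (n : ℝ) * (12 * R) ≤ n * (n * τ) := mul_le_mul_of_nonneg_left hn1 hnpos.le
      nlinarith
    have t2 : x * (k * C) ≤ τ / 3 * C := by
      calc _ = x * k * C := by ring
        _ ≤ _ := by gcongr
    have t3 : k * η * (n : ℝ) ^ 2 * Lg ≤ τ / 3 * C := by
      calc _ = (k * η * Lg) * (n : ℝ) ^ 2 := by ring
        _ ≤ (k * η * Lg) * (4 * C) := by gcongr
        _ = (4 * k * Lg * η) * C := by ring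
        _ ≤ _ := by gcongr
    calc _ ≤ τ / 3 * C + (τ / 3 * C + τ / 3 * C) := by gcongr
      _ = _ := by rw [hτ]; ring
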